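/- arXiv:1002.0278 — 2 statements merged into one kernel-verified Lean document; each statement's English description precedes it below -/
import Mathlib

section
/- Let D be a commutative Dedekind domain, σ an automorphism of D, δ a σ-derivation, and R = D[x; σ, δ]. If 𝔭 is a (σ, δ)-prime ideal of D, then the extension 𝔭R is a prime ideal of R, and in particular 𝔭 = P ∩ D for some prime ideal P of R. -/
open Polynomial Finset

/-- An Ore extension `R = D[x; σ, δ]`: a ring `R` containing (an image of) `D`,
with an element `x` satisfying `x·a = σ(a)x + δ(a)`, which is a free left
`D`-module with basis `1, x, x², …` (every element has a unique polynomial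
representation with left-hand coefficients). -/
structure OreData (D : Type*) (R : Type*) [Ring D] [Ring R]
    (σ : D →+* D) (δ : D → D) where
  i : D →+* R
  x : R
  comm : ∀ a : D, x * i a = i (σ a) * x + i (δ a)
  repr : ∀ f : R, ∃! g : Polynomial D, f = g.sum fun k a => i a * x ^ k

/-- `𝔭[x; σ, δ] = 𝔭R`: the set of elements of `R` all of whose coefficients lie in `𝔭`. -/
def OreData.pSet {D R : Type*} [Ring D] [Ring R] {σ : D →+* D} {δ : D → D}
    (O : OreData D R σ δ) (𝔭 : Ideal D) : Set R :=
  {f | ∃ g : Polynomial D, (∀ k, g.coeff k ∈ 𝔭) ∧ f = g.sum fun k a => O.i a * O.x ^ k}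

/-- A `(σ, δ)`-ideal: an ideal stable under `σ` and `δ`. -/
def SDIdeal {D : Type*} [CommRing D] (σ δ : D → D) (I : Ideal D) : Prop :=
  (∀ a ∈ I, σ a ∈ I) ∧ (∀ a ∈ I, δ a ∈ I)

/-- A `(σ, δ)`-prime ideal: a proper `(σ, δ)`-ideal `I` such that `JK ⊆ I` for
`(σ, δ)`-ideals `J, K` implies `J ⊆ I` or `K ⊆ I`. -/
def SDPrime {D : Type*} [CommRing D] (σ δ : D → D) (I : Ideal D) : Prop :=
  I ≠ ⊤ ∧ SDIdeal σ δ I ∧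
    ∀ J K : Ideal D, SDIdeal σ δ J → SDIdeal σ δ K → J * K ≤ I → J ≤ I ∨ K ≤ I

/-- Minimal among nonzero `(σ, δ)`-prime ideals. -/
def MinSDPrime {D : Type*} [CommRing D] (σ δ : D → D) (I : Ideal D) : Prop :=
  I ≠ ⊥ ∧ SDPrime σ δ I ∧ ∀ J : Ideal D, SDPrime σ δ J → J ≠ ⊥ → J ≤ I → J = I

/-- A (two-sided) ideal of a possibly noncommutative ring, as a set. -/
def IsTwoSidedIdealSet {R : Type*} [Ring R] (P : Set R) : Prop :=
  0 ∈ P ∧ (∀ a b : R, a ∈ P → b ∈ P → a + b ∈ P) ∧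
    (∀ r a : R, a ∈ P → r * a ∈ P) ∧ (∀ r a : R, a ∈ P → a * r ∈ P)

/-- A prime (two-sided) ideal of a possibly noncommutative ring. -/
def IsPrimeTS {R : Type*} [Ring R] (P : Set R) : Prop :=
  IsTwoSidedIdealSet P ∧ P ≠ Set.univ ∧
    ∀ a b : R, (∀ r : R, a * r * b ∈ P) → a ∈ P ∨ b ∈ P

/-- Minimal among nonzero prime (two-sided) ideals of `R`. -/
def MinimalPrimeTS {R : Type*} [Ring R] (P : Set R) : Prop :=
  IsPrimeTS P ∧ P ≠ {0} ∧ ∀ Q : Set R, IsPrimeTS Q → Q ≠ {0} → Q ⊆ P → Q = P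

namespace OreData
variable {D R : Type*} [CommRing D] [Ring R] {σ : D ≃+* D} {δ : D → D}
  (O : OreData D R (σ : D →+* D) δ)

noncomputable def cf (f : R) : Polynomial D := Classical.choose (O.repr f)

lemma cf_spec (f : R) : f = (O.cf f).sum fun k a => O.i a * O.x ^ k :=
  (Classical.choose_spec (O.repr f)).1

lemma cf_eq (f : R) (g : Polynomial D) (h : f = g.sum fun k a => O.i a * O.x ^ k) :
    O.cf f = g :=
  ((Classical.choose_spec (O.repr f)).2 g h).symm

lemma cf_add (f g : R) : O.cf (f + g) = O.cf f + O.cf g := by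
  apply cf_eq
  rw [Polynomial.sum_add_index _ _ _ (by simp) (by intros; simp [add_mul]),
    ← cf_spec, ← cf_spec]

noncomputable def cfHom : R →+ Polynomial D := AddMonoidHom.mk' O.cf O.cf_add

lemma cf_zero : O.cf 0 = 0 := O.cfHom.map_zero
lemma cf_sub (f g : R) : O.cf (f - g) = O.cf f - O.cf g := O.cfHom.map_sub f g
lemma cf_sum {ι : Type*} (s : Finset ι) (f : ι → R) :
    O.cf (∑ j ∈ s, f j) = ∑ j ∈ s, O.cf (f j) := map_sum O.cfHom f s

lemma cf_mono (a : D) (n : ℕ) : O.cf (O.i a * O.x ^ n) = Polynomial.monomial n a := by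
  apply cf_eq
  rw [Polynomial.sum_monomial_index _ _ (by simp)]

lemma cf_i (a : D) : O.cf (O.i a) = Polynomial.C a := by
  simpa using O.cf_mono a 0

lemma ind {P : R → Prop} (hz : P 0) (ha : ∀ f g, P f → P g → P (f + g))
    (hm : ∀ a n, P (O.i a * O.x ^ n)) (f : R) : P f := by
  rw [O.cf_spec f, Polynomial.sum_def]
  exact Finset.sum_induction _ P ha hz (fun k _ => hm _ _)

lemma cf_i_mul (d : D) (f : R) (k : ℕ) :
    (O.cf (O.i d * f)).coeff k = d * (O.cf f).coeff k := by
  induction f using O.ind with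
  | hz => simp [cf_zero]
  | ha f g hf hg => simp only [mul_add, cf_add, Polynomial.coeff_add, hf, hg]
  | hm a n =>
    rw [← mul_assoc, ← map_mul, cf_mono, cf_mono]
    simp [Polynomial.coeff_monomial]

lemma cf_mul_x (f : R) (k : ℕ) :
    (O.cf (f * O.x)).coeff (k + 1) = (O.cf f).coeff k := by
  induction f using O.ind with
  | hz => simp [cf_zero]
  | ha f g hf hg => simp only [add_mul, cf_add, Polynomial.coeff_add, hf, hg]
  | hm a n =>
    rw [mul_assoc, ← pow_succ, cf_mono, cf_mono]
    simp [Polynomial.coeff_monomial]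

lemma cf_mul_x_zero (f : R) : (O.cf (f * O.x)).coeff 0 = 0 := by
  induction f using O.ind with
  | hz => simp [cf_zero]
  | ha f g hf hg => simp only [add_mul, cf_add, Polynomial.coeff_add, hf, hg, add_zero]
  | hm a n =>
    rw [mul_assoc, ← pow_succ, cf_mono]
    simp [Polynomial.coeff_monomial]

lemma cf_x_mul (hadd : ∀ a b : D, δ (a + b) = δ a + δ b) (f : R) (k : ℕ) :
    (O.cf (O.x * f)).coeff k = σ ((O.cf (f * O.x)).coeff k) + δ ((O.cf f).coeff k) := by
  have h0 : δ 0 = 0 := by simpa using hadd 0 0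
  induction f using O.ind with
  | hz => simp [cf_zero, h0]
  | ha f g hf hg =>
    simp only [mul_add, add_mul, cf_add, Polynomial.coeff_add, hf, hg, hadd, map_add]
    ring
  | hm a n =>
    have : O.x * (O.i a * O.x ^ n) = O.i (σ a) * O.x ^ (n + 1) + O.i (δ a) * O.x ^ n := by
      rw [← mul_assoc, O.comm, add_mul, mul_assoc, ← pow_succ']; rfl
    rw [this, mul_assoc (O.i a), ← pow_succ, cf_add, cf_mono, cf_mono, cf_mono, cf_mono]
    simp only [Polynomial.coeff_add, Polynomial.coeff_monomial]
    split_ifs <;> simp [h0]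

lemma cf_mul (f g : R) (k : ℕ) : (O.cf (f * g)).coeff k =
    ∑ j ∈ (O.cf f).support, (O.cf f).coeff j * (O.cf (O.x ^ j * g)).coeff k := by
  conv_lhs => rw [O.cf_spec f, Polynomial.sum_def, Finset.sum_mul, cf_sum,
    Polynomial.finsetSum_coeff]
  refine Finset.sum_congr rfl fun j _ => ?_
  rw [mul_assoc, cf_i_mul]

lemma mem_pSet (p : Ideal D) (f : R) : f ∈ O.pSet p ↔ ∀ k, (O.cf f).coeff k ∈ p := by
  constructor
  · rintro ⟨g, hg, h⟩
    rwa [O.cf_eq f g h]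
  · exact fun h => ⟨_, h, O.cf_spec f⟩

lemma xpow_top (hadd : ∀ a b : D, δ (a + b) = δ a + δ b) (p : Ideal D)
    (hp : SDIdeal (⇑σ) δ p) (g : R) (m : ℕ) (hg : ∀ k, m < k → (O.cf g).coeff k ∈ p) (j : ℕ) :
    (∀ k, m + j < k → (O.cf (O.x ^ j * g)).coeff k ∈ p) ∧
    (O.cf (O.x ^ j * g)).coeff (m + j) - (⇑σ)^[j] ((O.cf g).coeff m) ∈ p := by
  induction j with
  | zero => simpa using hg
  | succ j ih =>
    obtain ⟨h1, h2⟩ := ih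
    rw [pow_succ', mul_assoc]
    constructor
    · intro k hk
      obtain ⟨k, rfl⟩ : ∃ l, k = l + 1 := ⟨k - 1, by omega⟩
      rw [O.cf_x_mul hadd, cf_mul_x]
      exact p.add_mem (hp.1 _ (h1 _ (by omega))) (hp.2 _ (h1 _ (by omega)))
    · rw [O.cf_x_mul hadd, ← add_assoc, cf_mul_x, Function.iterate_succ_apply', add_sub_right_comm,
        ← map_sub]
      exact p.add_mem (hp.1 _ h2) (hp.2 _ (h1 _ (by omega)))

lemma xpow_mem (hadd : ∀ a b : D, δ (a + b) = δ a + δ b) (p : Ideal D)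
    (hp : SDIdeal (⇑σ) δ p) (g : R) (hg : g ∈ O.pSet p) (j : ℕ) :
    O.x ^ j * g ∈ O.pSet p := by
  rw [mem_pSet] at *
  induction j with
  | zero => simpa using hg
  | succ j ih =>
    intro k
    rw [pow_succ', mul_assoc, O.cf_x_mul hadd]
    refine p.add_mem (hp.1 _ ?_) (hp.2 _ (ih _))
    cases k with
    | zero => rw [cf_mul_x_zero]; exact p.zero_mem
    | succ k => rw [cf_mul_x]; exact ih _

lemma twoSided (hadd : ∀ a b : D, δ (a + b) = δ a + δ b) (p : Ideal D)
    (hp : SDIdeal (⇑σ) δ p) : IsTwoSidedIdealSet (O.pSet p) := by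
  refine ⟨?_, ?_, ?_, ?_⟩
  · simp [mem_pSet, cf_zero]
  · intro a b ha hb
    rw [mem_pSet] at *
    intro k
    rw [cf_add, Polynomial.coeff_add]
    exact p.add_mem (ha k) (hb k)
  · intro r a ha
    rw [mem_pSet]
    intro k
    rw [cf_mul]
    exact p.sum_mem fun j _ => p.mul_mem_left _
      ((O.mem_pSet _ _).1 (O.xpow_mem hadd p hp a ha j) k)
  · intro r a ha
    rw [mem_pSet] at *
    intro k
    rw [cf_mul]
    exact p.sum_mem fun j _ => p.mul_mem_right _ (ha j)

lemma mul_top (hadd : ∀ a b : D, δ (a + b) = δ a + δ b) (p : Ideal D)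
    (hp : SDIdeal (⇑σ) δ p) (f g : R) (n m : ℕ)
    (hf : ∀ k, n < k → (O.cf f).coeff k ∈ p)
    (hg : ∀ k, m < k → (O.cf g).coeff k ∈ p) (h : f * g ∈ O.pSet p) :
    (O.cf f).coeff n * (⇑σ)^[n] ((O.cf g).coeff m) ∈ p := by
  rw [mem_pSet] at h
  have h1 := h (m + n)
  rw [cf_mul, ← Ideal.Quotient.eq_zero_iff_mem, map_sum, Finset.sum_eq_single n,
    Ideal.Quotient.eq_zero_iff_mem] at h1
  · have h2 := p.mul_mem_left ((O.cf f).coeff n) (O.xpow_top hadd p hp g m hg n).2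
    have := p.sub_mem h1 h2
    convert this using 1
    ring
  · intro j _ hj
    rw [Ideal.Quotient.eq_zero_iff_mem]
    rcases lt_or_gt_of_ne hj with hj | hj
    · exact p.mul_mem_left _ ((O.xpow_top hadd p hp g m hg j).1 _ (by omega))
    · exact p.mul_mem_right _ (hf _ hj)
  · intro hn
    rw [Polynomial.notMem_support_iff] at hn
    simp [hn]

lemma exists_top (p : Ideal D) (f : R) (hf : f ∉ O.pSet p) :
    ∃ n, (∀ k, n < k → (O.cf f).coeff k ∈ p) ∧ (O.cf f).coeff n ∉ p := by
  classical
  rw [mem_pSet] at hf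
  push Not at hf
  obtain ⟨k, hk⟩ := hf
  let s := (O.cf f).support.filter fun k => (O.cf f).coeff k ∉ p
  have hs : ∀ k, (O.cf f).coeff k ∉ p → k ∈ s := by
    intro k hk
    simp only [s, Finset.mem_filter, Polynomial.mem_support_iff]
    exact ⟨fun h => hk (h ▸ p.zero_mem), hk⟩
  have hne : s.Nonempty := ⟨k, hs k hk⟩
  refine ⟨s.max' hne, ?_, (Finset.mem_filter.1 (s.max'_mem hne)).2⟩
  intro j hj
  by_contra hc
  exact absurd (s.le_max' _ (hs j hc)) (by omega)

end OreData

section DedekindPart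
variable {D : Type*} [CommRing D] {σ : D ≃+* D} {δ : D → D}

lemma sigma_mem_iff [IsNoetherianRing D] (I : Ideal D) (h : ∀ a ∈ I, σ a ∈ I) (a : D) :
    σ a ∈ I ↔ a ∈ I := by
  refine ⟨fun ha => ?_, h a⟩
  let J : ℕ →o Ideal D := monotone_nat_of_le_succ (f := fun k => I.comap ((σ : D →+* D) ^ k))
    (by
      intro k a ha
      simp only [Ideal.mem_comap, pow_succ', RingHom.mul_def, RingHom.comp_apply] at *
      exact h _ ha) |> OrderHom.mk _
  obtain ⟨n, hn⟩ := monotone_stabilizes_iff_noetherian.2 ‹IsNoetherianRing D› J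
  have h1 := hn (n + 1) (by omega)
  obtain ⟨b, rfl⟩ : ∃ b, ((σ : D →+* D) ^ n) b = a := by
    have : Function.Surjective ((σ : D →+* D) ^ n) := by
      rw [RingHom.coe_pow]; exact σ.surjective.iterate n
    exact this a
  have : b ∈ J n := by
    rw [h1]
    simp only [J, OrderHom.coe_mk, Ideal.mem_comap, pow_succ', RingHom.mul_def,
      RingHom.comp_apply]
    exact ha
  exact this

lemma iter_mem_iff [IsNoetherianRing D] (I : Ideal D) (h : ∀ a ∈ I, σ a ∈ I) (n : ℕ) (a : D) :
    (⇑σ)^[n] a ∈ I ↔ a ∈ I := by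
  induction n with
  | zero => simp
  | succ n ih => rw [Function.iterate_succ_apply', sigma_mem_iff I h, ih]

/-- annihilator ideals modulo a radical SD ideal are SD -/
lemma colon_sd [IsNoetherianRing D]
    (hleib : ∀ a b : D, δ (a * b) = σ a * δ b + δ a * b)
    (p K : Ideal D) (hp : SDIdeal (⇑σ) δ p) (hr : p.IsRadical) (hK : ∀ a ∈ K, σ a ∈ K)
    (J : Ideal D) (hJ : ∀ a, a ∈ J ↔ ∀ k ∈ K, a * k ∈ p) : SDIdeal (⇑σ) δ J := by
  have h1 : ∀ a ∈ J, σ a ∈ J := by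
    intro a ha
    rw [hJ] at *
    intro k hk
    obtain ⟨l, rfl⟩ := σ.surjective k
    rw [← map_mul]
    exact hp.1 _ (ha _ ((sigma_mem_iff K hK l).1 hk))
  refine ⟨h1, fun a ha => (hJ _).2 fun k hk => hr ⟨2, ?_⟩⟩
  have h2 := p.mul_mem_right (δ a * 0 + k) (hp.2 _ ((hJ _).1 ha k hk))
  have h3 := p.mul_mem_left (δ k) ((hJ _).1 (h1 a ha) k hk)
  rw [hleib] at h2
  have := p.mul_mem_left (δ a) (p.sub_mem h2 h3)
  convert this using 1
  ring

lemma colon_exists (p K : Ideal D) : ∃ J : Ideal D, ∀ a, a ∈ J ↔ ∀ k ∈ K, a * k ∈ p :=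
  ⟨{ carrier := {a | ∀ k ∈ K, a * k ∈ p}
     add_mem' := fun ha hb k hk => by rw [add_mul]; exact p.add_mem (ha k hk) (hb k hk)
     zero_mem' := fun k _ => by simp
     smul_mem' := fun c a ha k hk => by
      rw [smul_eq_mul, mul_assoc]; exact p.mul_mem_left _ (ha k hk) }, fun _ => Iff.rfl⟩

lemma radical_case [IsNoetherianRing D]
    (hleib : ∀ a b : D, δ (a * b) = σ a * δ b + δ a * b)
    (p : Ideal D) (hp : SDPrime (⇑σ) δ p) (hr : p.IsRadical) (a b : D) (n : ℕ)
    (h : ∀ k, a * (⇑σ)^[n] ((⇑σ)^[k] b) ∈ p) : a ∈ p ∨ b ∈ p := by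
  let K : Ideal D := Ideal.span (Set.range fun k => (⇑σ)^[n] ((⇑σ)^[k] b))
  have hK : ∀ c ∈ K, σ c ∈ K := by
    intro c hc
    have : K ≤ K.comap (σ : D →+* D) := by
      refine Ideal.span_le.2 ?_
      rintro _ ⟨k, rfl⟩
      refine Ideal.subset_span ⟨k + 1, ?_⟩
      simp only [← Function.iterate_add_apply]
      rw [← add_assoc, Function.iterate_succ_apply']
      rfl
    exact this hc
  have hbK : b ∈ K := by
    rw [← iter_mem_iff K hK n]
    exact Ideal.subset_span ⟨0, rfl⟩
  obtain ⟨J, hJ⟩ := colon_exists p K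
  have hJs := colon_sd hleib p K hp.2.1 hr hK J hJ
  obtain ⟨L, hL⟩ := colon_exists p J
  have hLs := colon_sd hleib p J hp.2.1 hr hJs.1 L hL
  have haJ : a ∈ J := by
    rw [hJ]
    intro k hk
    obtain ⟨M, hM⟩ := colon_exists p (Ideal.span {a})
    have : K ≤ M := by
      refine Ideal.span_le.2 ?_
      rintro _ ⟨k, rfl⟩
      refine (hM _).2 fun c hc => ?_
      obtain ⟨d, rfl⟩ := Ideal.mem_span_singleton'.1 hc
      have := p.mul_mem_left d (h k)
      convert this using 1
      ring
    rw [mul_comm]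
    exact (hM _).1 (this hk) a (Ideal.mem_span_singleton_self a)
  have hbL : b ∈ L := by
    rw [hL]
    intro k hk
    rw [mul_comm]
    exact (hJ _).1 hk b hbK
  rcases hp.2.2 J L hJs hLs (Ideal.mul_le.2 fun r hr s hs => by
    rw [mul_comm]; exact (hL _).1 hs r hr) with h | h
  · exact Or.inl (h haJ)
  · exact Or.inr (h hbL)

lemma sd_pow_le (hadd : ∀ a b : D, δ (a + b) = δ a + δ b)
    (hleib : ∀ a b : D, δ (a * b) = σ a * δ b + δ a * b)
    (p : Ideal D) (hp : SDPrime (⇑σ) δ p) (J : Ideal D) (hJ : SDIdeal (⇑σ) δ J) (n : ℕ)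
    (h : J ^ n ≤ p) : J ≤ p := by
  have hs : ∀ n, SDIdeal (⇑σ) δ (J ^ n) := by
    intro n
    induction n with
    | zero => simp [SDIdeal]
    | succ n ih =>
      rw [pow_succ]
      have h1 : ∀ a ∈ J ^ n * J, σ a ∈ J ^ n * J := by
        intro a ha
        refine Submodule.mul_induction_on ha ?_ ?_
        · intro r hr s hs
          rw [map_mul]
          exact Ideal.mul_mem_mul (ih.1 _ hr) (hJ.1 _ hs)
        · intro x y hx hy
          rw [map_add]
          exact Ideal.add_mem _ hx hy
      refine ⟨h1, fun a ha => ?_⟩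
      refine Submodule.mul_induction_on ha ?_ ?_
      · intro r hr s hs
        rw [hleib]
        exact Ideal.add_mem _ (Ideal.mul_mem_mul (ih.1 _ hr) (hJ.2 _ hs))
          (Ideal.mul_mem_mul (ih.2 _ hr) hs)
      · intro x y hx hy
        rw [hadd]
        exact Ideal.add_mem _ hx hy
  induction n with
  | zero =>
    rw [pow_zero, Ideal.one_eq_top] at h
    exact le_top.trans h
  | succ n ih =>
    rw [pow_succ] at h
    rcases hp.2.2 _ _ (hs n) hJ h with h | h
    · exact ih h
    · exact h

lemma sup_pow [IsDedekindDomain D] (P : Ideal D) [P.IsMaximal] (i e : ℕ)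
    (hie : i ≤ e) (a : D) (ha : a ∈ P ^ i) (ha' : a ∉ P ^ (i + 1)) (c : D) (hc : c ∈ P ^ i) :
    ∃ d, c - d * a ∈ P ^ e := by
  have h1 : P ^ i ∣ Ideal.span {a} := by
    rw [Ideal.dvd_iff_le, Ideal.span_singleton_le_iff_mem]; exact ha
  obtain ⟨Q, hQ⟩ := h1
  have hQP : ¬ Q ≤ P := by
    intro h
    apply ha'
    rw [← Ideal.span_singleton_le_iff_mem, hQ, pow_succ]
    exact Ideal.mul_mono_right h
  have h2 : Q ⊔ P ^ (e - i) = ⊤ := by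
    apply Ideal.sup_pow_eq_top
    rw [sup_comm]
    by_contra hne
    have := Ideal.IsMaximal.eq_of_le (I := P) inferInstance hne le_sup_left
    exact hQP (this ▸ le_sup_right)
  have h3 : P ^ i = Ideal.span {a} ⊔ P ^ e := by
    obtain ⟨l, rfl⟩ := Nat.exists_eq_add_of_le hie
    rw [Nat.add_sub_cancel_left] at h2
    rw [hQ, pow_add, ← Ideal.mul_sup, h2, Ideal.mul_top]
  rw [h3] at hc
  obtain ⟨d, y, hy, hcd⟩ := Ideal.mem_span_singleton_sup.1 hc
  exact ⟨d, by rw [← hcd]; simpa using hy⟩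

lemma nonradical_case [IsDedekindDomain D] (hadd : ∀ a b : D, δ (a + b) = δ a + δ b)
    (hleib : ∀ a b : D, δ (a * b) = σ a * δ b + δ a * b)
    (p : Ideal D) (hp : SDPrime (⇑σ) δ p) (hr : ¬ p.IsRadical) :
    ∃ (P : Ideal D) (e : ℕ), P.IsMaximal ∧ P ≠ ⊥ ∧ p = P ^ e ∧ ∀ n, ∀ b ∈ P ^ n, σ b ∈ P ^ n := by
  have hNσ : ∀ a ∈ p.radical, σ a ∈ p.radical := by
    rintro a ⟨n, hn⟩
    exact ⟨n, by rw [← map_pow]; exact hp.2.1.1 _ hn⟩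
  have hδ : ¬ ∀ a ∈ p.radical, δ a ∈ p.radical := by
    intro hd
    obtain ⟨n, hn⟩ := p.exists_radical_pow_le_of_fg p.radical.fg_of_isNoetherianRing
    exact hr (sd_pow_le hadd hleib p hp _ ⟨hNσ, hd⟩ n hn)
  push Not at hδ
  obtain ⟨a, haN, haδ⟩ := hδ
  have hp0 : p ≠ ⊥ := by
    rintro rfl
    apply hr
    exact Ideal.isPrime_bot.isRadical
  rw [Ideal.radical_eq_sInf, Ideal.mem_sInf] at haδ
  push Not at haδ
  obtain ⟨P, ⟨hpP, hPp⟩, haP⟩ := haδ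
  have hP0 : P ≠ ⊥ := fun h => hp0 (le_bot_iff.1 (h ▸ hpP))
  have hPm : P.IsMaximal := hPp.isMaximal hP0
  have hNP : p.radical ≤ P := hPp.radical_le_iff.2 hpP
  have hσP : ∀ b, σ b - b ∈ P := by
    intro b
    have h1 := hleib a b
    have h2 := hleib b a
    rw [mul_comm b a, h1] at h2
    have h3 : (σ b - b) * δ a ∈ P := by
      have : (σ b - b) * δ a = (σ a - a) * δ b := by linear_combination -h2
      rw [this]
      exact P.mul_mem_right _ (P.sub_mem (hNP (hNσ a haN)) (hNP haN))
    exact (hPp.mem_or_mem h3).resolve_right haP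
  have hσP1 : ∀ b ∈ P, σ b ∈ P := fun b hb => by
    have := P.add_mem (hσP b) hb
    simpa using this
  have hσPn : ∀ n, ∀ b ∈ P ^ n, σ b ∈ P ^ n := by
    intro n b hb
    have : P ^ n ≤ (P ^ n).comap (σ : D →+* D) := by
      rw [← Ideal.map_le_iff_le_comap, Ideal.map_pow]
      exact Ideal.pow_right_mono (Ideal.map_le_iff_le_comap.2 hσP1) n
    exact this hb
  have hPprime : Prime P := Ideal.prime_of_isPrime hP0 hPp
  obtain ⟨Q, hpQ, hQP⟩ := (FiniteMultiplicity.of_prime_left hPprime hp0).exists_eq_pow_mul_and_not_dvd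
  set e := multiplicity P p
  rw [Ideal.dvd_iff_le] at hQP
  have hcop : P ^ e ⊔ Q = ⊤ := by
    apply Ideal.pow_sup_eq_top
    by_contra hne
    have := Ideal.IsMaximal.eq_of_le hPm hne le_sup_left
    exact hQP (this ▸ le_sup_right)
  have hQ : ∀ c, c ∈ Q ↔ ∀ k ∈ P ^ e, c * k ∈ p := by
    intro c
    constructor
    · intro hc k hk
      rw [hpQ, mul_comm c k]
      exact Ideal.mul_mem_mul hk hc
    · intro h
      obtain ⟨u, hu, v, hv, huv⟩ := Submodule.mem_sup.1 ((Ideal.eq_top_iff_one _).1 hcop)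
      have h1 : c * u ∈ Q := (hpQ ▸ Ideal.mul_le_right : p ≤ Q) (h u hu)
      have := Q.add_mem h1 (Q.mul_mem_left c hv)
      rwa [← mul_add, huv, mul_one] at this
  have key : ∀ J K : Ideal D, J ⊔ K = ⊤ → p = J * K → (∀ b ∈ J, σ b ∈ J) → 
      ∀ b ∈ J, δ b ∈ J := by
    intro J K hJK hpJ hσJ b hb
    obtain ⟨u, hu, v, hv, huv⟩ := Submodule.mem_sup.1 ((Ideal.eq_top_iff_one _).1 hJK)
    have h1 : δ (b * v) ∈ J :=
      (hpJ ▸ Ideal.mul_le_left : p ≤ J) (hp.2.1.2 _ (hpJ ▸ Ideal.mul_mem_mul hb hv))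
    rw [hleib] at h1
    have h2 := J.add_mem (J.sub_mem h1 (J.mul_mem_right (δ v) (hσJ b hb))) (J.mul_mem_left (δ b) hu)
    have h3 : δ b = σ b * δ v + δ b * v - σ b * δ v + δ b * u := by
      linear_combination (-δ b) * huv
    rw [h3]; exact h2
  have hQσ : ∀ b ∈ Q, σ b ∈ Q := by
    intro b hb
    rw [hQ] at *
    intro k hk
    obtain ⟨l, rfl⟩ := σ.surjective k
    rw [← map_mul]
    exact hp.2.1.1 _ (hb _ ((sigma_mem_iff _ (hσPn e) l).1 hk))
  refine ⟨P, e, hPm, hP0, ?_, hσPn⟩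
  rcases hp.2.2 (P ^ e) Q ⟨hσPn e, key _ _ hcop hpQ (hσPn e)⟩
    ⟨hQσ, key _ _ (by rw [sup_comm]; exact hcop) (by rw [mul_comm]; exact hpQ) hQσ⟩ hpQ.ge with h | h
  · exact le_antisymm (hpQ ▸ Ideal.mul_le_left) h
  · exact absurd (h.trans hpP) hQP

end DedekindPart

lemma local_case {D R : Type*} [CommRing D] [IsDedekindDomain D] [Ring R]
    {σ : D ≃+* D} {δ : D → D}
    (hadd : ∀ a b : D, δ (a + b) = δ a + δ b)
    (hleib : ∀ a b : D, δ (a * b) = σ a * δ b + δ a * b)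
    (O : OreData D R (σ : D →+* D) δ)
    (p : Ideal D) (hp : SDPrime (⇑σ) δ p) (P : Ideal D) (e : ℕ) (hPm : P.IsMaximal)
    (hP0 : P ≠ ⊥) (hpe : p = P ^ e) (hσ : ∀ n, ∀ b ∈ P ^ n, σ b ∈ P ^ n)
    (f₀ b : R) (hf₀ : f₀ ∉ O.pSet p) (hb : b ∉ O.pSet p)
    (h : ∀ r, f₀ * r * b ∈ O.pSet p) : False := by
  classical
  obtain ⟨hS0, hSadd, hSl, hSr⟩ := O.twoSided hadd p hp.2.1
  let I : R → Prop := fun f => ∀ r, f * r * b ∈ O.pSet p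
  have hIl : ∀ s f, I f → I (s * f) := fun s f hf r => by
    have := hSl s _ (hf r)
    simpa only [mul_assoc] using this
  have hIr : ∀ s f, I f → I (f * s) := fun s f hf r => by
    have := hf (s * r)
    simpa only [mul_assoc] using this
  have hIsub : ∀ f g, I f → I g → I (f - g) := fun f g hf hg r => by
    have := hSadd _ _ (hf r) (hSl (-1) _ (hg r))
    convert this using 1
    noncomm_ring
  have hQ : ∃ n, ∃ f, I f ∧ f ∉ O.pSet p ∧ ∀ k, n < k → (O.cf f).coeff k ∈ p := by
    obtain ⟨n, hn, _⟩ := O.exists_top p f₀ hf₀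
    exact ⟨n, f₀, h, hf₀, hn⟩
  obtain ⟨n, hn, hnmin⟩ : ∃ n, (∃ f, I f ∧ f ∉ O.pSet p ∧ ∀ k, n < k → (O.cf f).coeff k ∈ p) ∧
      ∀ m < n, ¬ (∃ f, I f ∧ f ∉ O.pSet p ∧ ∀ k, m < k → (O.cf f).coeff k ∈ p) :=
    ⟨Nat.find hQ, Nat.find_spec hQ, fun m hm => Nat.find_min hQ hm⟩
  have hdrop : ∀ f, I f → (∀ k, n < k → (O.cf f).coeff k ∈ p) → (O.cf f).coeff n ∈ p →
      f ∈ O.pSet p := by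
    intro f hf hk hfn
    by_contra hfS
    obtain ⟨m, hm, hm'⟩ := O.exists_top p f hfS
    refine hnmin m ?_ ⟨f, hf, hfS, hm⟩
    by_contra hmn
    rcases eq_or_lt_of_le (not_lt.1 hmn) with h | h
    · exact hm' (h ▸ hfn)
    · exact hm' (hk _ h)
  have he : e ≠ 0 := by
    rintro rfl
    exact hp.1 (by rw [hpe, pow_zero, Ideal.one_eq_top])
  have hT : ∃ i, ∃ f, I f ∧ (∀ k, n < k → (O.cf f).coeff k ∈ p) ∧
      (O.cf f).coeff n ∉ P ^ (i + 1) := by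
    obtain ⟨f, hf, hfS, hk⟩ := hn
    refine ⟨e - 1, f, hf, hk, fun hc => hfS (hdrop f hf hk ?_)⟩
    rwa [Nat.sub_add_cancel (Nat.pos_of_ne_zero he), ← hpe] at hc
  obtain ⟨i, ⟨f, hf, hfk, hfn⟩, himin⟩ : ∃ i, (∃ f, I f ∧ (∀ k, n < k → (O.cf f).coeff k ∈ p) ∧
      (O.cf f).coeff n ∉ P ^ (i + 1)) ∧ ∀ j < i, ¬ (∃ f, I f ∧
      (∀ k, n < k → (O.cf f).coeff k ∈ p) ∧ (O.cf f).coeff n ∉ P ^ (j + 1)) :=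
    ⟨Nat.find hT, Nat.find_spec hT, fun m hm => Nat.find_min hT hm⟩
  have hall : ∀ f, I f → (∀ k, n < k → (O.cf f).coeff k ∈ p) → (O.cf f).coeff n ∈ P ^ i := by
    intro f hf hk
    cases i with
    | zero => simp
    | succ j =>
      by_contra hc
      exact himin j (by omega) ⟨f, hf, hk, hc⟩
  have hfi := hall f hf hfk
  by_cases hie : e < i + 1
  · -- then the minimality is violated
    obtain ⟨f, hf, hfS, hk⟩ := hn
    refine hfS (hdrop f hf hk ?_)
    rw [hpe]
    exact Ideal.pow_le_pow_right (by omega) (hall f hf hk)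
  have hie' : i + 1 ≤ e := not_lt.1 hie
  obtain rfl | hi := Nat.eq_zero_or_pos i
  · obtain ⟨m, hm, hm'⟩ := O.exists_top p b hb
    have h1 : f * b ∈ O.pSet p := by simpa using hf 1
    have h2 := O.mul_top hadd p hp.2.1 f b n m hfk hm h1
    obtain ⟨d, hd⟩ := sup_pow P 0 e (by omega) _ hfi hfn 1 (by simp)
    rw [← hpe] at hd
    apply hm'
    rw [← iter_mem_iff p hp.2.1.1 n]
    have := p.add_mem (p.mul_mem_right ((⇑σ)^[n] ((O.cf b).coeff m)) hd) (p.mul_mem_left d h2)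
    convert this using 1
    ring
  · have hcoef : ∀ l, (O.cf f).coeff l ∈ P ^ i := by
      intro l
      have h1 : Ideal.span {(O.cf f).coeff l} * P ^ (e - i) ≤ P ^ i * P ^ (e - i) := by
        rw [← pow_add, Nat.add_sub_cancel' (by omega), ← hpe, Ideal.span_singleton_mul_le_iff]
        intro s hs
        have h2 : O.i s * f ∈ O.pSet p := by
          refine hdrop _ (hIl _ _ hf) ?_ ?_
          · intro k hk
            rw [O.cf_i_mul]
            exact p.mul_mem_left _ (hfk k hk)
          · rw [O.cf_i_mul, hpe, ← Nat.sub_add_cancel (show i ≤ e by omega), pow_add]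
            exact Ideal.mul_mem_mul (by simpa using hs) hfi
        have h3 := (O.mem_pSet p _).1 h2 l
        rw [O.cf_i_mul] at h3
        rwa [mul_comm]
      rw [← Ideal.dvd_iff_le, mul_dvd_mul_iff_right (pow_ne_zero _ hP0), Ideal.dvd_iff_le,
        Ideal.span_singleton_le_iff_mem] at h1
      exact h1
    obtain ⟨c, hc⟩ := sup_pow P i e (by omega) _ hfi hfn _ (hσ i _ hfi)
    have hg : ∀ k, (O.cf (O.x * f - O.i c * (f * O.x))).coeff k =
        σ ((O.cf (f * O.x)).coeff k) + δ ((O.cf f).coeff k) - c * (O.cf (f * O.x)).coeff k := by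
      intro k
      rw [O.cf_sub, Polynomial.coeff_sub, O.cf_x_mul hadd, O.cf_i_mul]
    have hgn := hall (O.x * f - O.i c * (f * O.x))
      (hIsub _ _ (hIl _ _ hf) (hIl _ _ (hIr _ _ hf))) (by
        intro k hk
        obtain ⟨k, rfl⟩ : ∃ l, k = l + 1 := ⟨k - 1, by omega⟩
        rw [hg, O.cf_mul_x, add_sub_right_comm]
        refine p.add_mem ?_ (hp.2.1.2 _ (hfk _ hk))
        rcases eq_or_lt_of_le (Nat.lt_succ_iff.1 hk) with h | h
        · rw [← h, hpe]; exact hc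
        · exact p.sub_mem (hp.2.1.1 _ (hfk _ h)) (p.mul_mem_left _ (hfk _ h)))
    have hfx : (O.cf (f * O.x)).coeff n ∈ P ^ i := by
      cases n with
      | zero => rw [O.cf_mul_x_zero]; exact Ideal.zero_mem _
      | succ n => rw [O.cf_mul_x]; exact hcoef n
    have hδ : δ ((O.cf f).coeff n) ∈ P ^ i := by
      rw [hg] at hgn
      have := (P ^ i).add_mem ((P ^ i).sub_mem hgn (hσ i _ hfx)) ((P ^ i).mul_mem_left c hfx)
      convert this using 1
      ring
    have hsd : SDIdeal (⇑σ) δ (P ^ i) := by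
      refine ⟨hσ i, fun y hy => ?_⟩
      obtain ⟨d, hd⟩ := sup_pow P i e (by omega) _ hfi hfn y hy
      rw [← hpe] at hd
      have h1 : p ≤ P ^ i := by rw [hpe]; exact Ideal.pow_le_pow_right (by omega)
      have h2 : y = (y - d * (O.cf f).coeff n) + d * (O.cf f).coeff n := by ring
      rw [h2, hadd, hleib]
      exact (P ^ i).add_mem (h1 (hp.2.1.2 _ hd))
        ((P ^ i).add_mem ((P ^ i).mul_mem_left _ hδ) ((P ^ i).mul_mem_left _ hfi))
    have hle := sd_pow_le hadd hleib p hp _ hsd e (by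
      rw [hpe, ← pow_mul]
      exact Ideal.pow_le_pow_right (Nat.le_mul_of_pos_left e hi))
    apply hfn
    have := hle hfi
    rw [hpe] at this
    exact Ideal.pow_le_pow_right hie' this

/-- If `𝔭` is a `(σ, δ)`-prime ideal of a commutative Dedekind domain `D` and
`σ` is an automorphism, then `𝔭R` is a prime ideal of `R = D[x; σ, δ]`, and in
particular `𝔭 = P ∩ D` for some prime ideal `P` of `R`. -/
theorem stmt4 {D R : Type*} [CommRing D] [IsDomain D] [IsDedekindDomain D] [Ring R]
    (σ : D ≃+* D) (δ : D → D)
    (hadd : ∀ a b : D, δ (a + b) = δ a + δ b)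
    (hleib : ∀ a b : D, δ (a * b) = σ a * δ b + δ a * b)
    (O : OreData D R (σ : D →+* D) δ)
    (𝔭 : Ideal D) (h𝔭 : SDPrime (⇑σ) δ 𝔭) :
    IsPrimeTS (O.pSet 𝔭) ∧ ∃ P : Set R, IsPrimeTS P ∧ O.i ⁻¹' P = ↑𝔭 := by
  have hts := O.twoSided hadd 𝔭 h𝔭.2.1
  have hpre : ∀ d, O.i d ∈ O.pSet 𝔭 ↔ d ∈ 𝔭 := by
    intro d
    rw [O.mem_pSet, O.cf_i]
    constructor
    · intro h
      simpa using h 0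
    · intro h k
      rw [Polynomial.coeff_C]
      split_ifs
      · exact h
      · exact 𝔭.zero_mem
  have hprime : IsPrimeTS (O.pSet 𝔭) := by
    refine ⟨hts, ?_, ?_⟩
    · intro hu
      apply h𝔭.1
      rw [Ideal.eq_top_iff_one, ← hpre, hu]
      trivial
    · intro f b h
      by_contra hc
      push Not at hc
      obtain ⟨hf, hb⟩ := hc
      by_cases hr : 𝔭.IsRadical
      · obtain ⟨n, hn, hn'⟩ := O.exists_top 𝔭 f hf
        obtain ⟨m, hm, hm'⟩ := O.exists_top 𝔭 b hb
        refine (radical_case hleib 𝔭 h𝔭 hr _ _ n ?_).elim hn' hm'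
        intro k
        obtain ⟨h1, h2⟩ := O.xpow_top hadd 𝔭 h𝔭.2.1 b m hm k
        have h3 := O.mul_top hadd 𝔭 h𝔭.2.1 f (O.x ^ k * b) n (m + k) hn h1
          (by rw [← mul_assoc]; exact h _)
        have h4 := (iter_mem_iff 𝔭 h𝔭.2.1.1 n _).2 h2
        rw [iterate_map_sub] at h4
        have := 𝔭.sub_mem h3 (𝔭.mul_mem_left ((O.cf f).coeff n) h4)
        convert this using 1
        ring
      · obtain ⟨P, e, hPm, hP0, hpe, hσ⟩ := nonradical_case hadd hleib 𝔭 h𝔭 hr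
        exact local_case hadd hleib O 𝔭 h𝔭 P e hPm hP0 hpe hσ f b hf hb h
  exact ⟨hprime, _, hprime, Set.ext hpre⟩
end

section
/- Let D be a commutative Dedekind domain, σ ≠ 1 an automorphism, δ ≠ 0 a σ-derivation, R = D[x; σ, δ]. Let P be a prime ideal of R with P ∩ D = 𝔭 ≠ 0. If P is a minimal prime ideal of R, then either P = 𝔭[x; σ, δ] with 𝔭 a minimal (σ, δ)-prime ideal of D, or (0) is the largest (σ, δ)-ideal of D contained in 𝔭. -/
open Polynomial Finset

namespace OreAux

section ring
variable {D R : Type*} [CommRing D] [Ring R] {σ : D ≃+* D} {δ : D → D}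
  (O : OreData D R (σ : D →+* D) δ)

/-- evaluation of a left polynomial -/
noncomputable def ev (g : Polynomial D) : R := g.sum fun k a => O.i a * O.x ^ k

/-- the coefficient polynomial -/
noncomputable def cf (f : R) : Polynomial D := (O.repr f).choose

theorem ev_cf (f : R) : ev O (cf O f) = f := (O.repr f).choose_spec.1.symm

theorem cf_ev (g : Polynomial D) : cf O (ev O g) = g :=
  ((O.repr (ev O g)).choose_spec.2 g rfl).symm

theorem ev_add (g h : Polynomial D) : ev O (g + h) = ev O g + ev O h := by
  unfold ev
  apply Polynomial.sum_add_index
  · intro k; simp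
  · intro k a b; simp [add_mul]

theorem ev_monomial (n : ℕ) (a : D) : ev O (monomial n a) = O.i a * O.x ^ n := by
  unfold ev
  rw [Polynomial.sum_monomial_index]
  simp

theorem cf_add (f h : R) : cf O (f + h) = cf O f + cf O h := by
  conv_lhs => rw [← ev_cf O f, ← ev_cf O h, ← ev_add]
  rw [cf_ev]

theorem cf_mono (n : ℕ) (a : D) : cf O (O.i a * O.x ^ n) = monomial n a := by
  rw [← ev_monomial, cf_ev]

/-- coefficient map -/
noncomputable def co (k : ℕ) : R →+ D :=
  AddMonoidHom.mk' (fun f => (cf O f).coeff k) (by intro a b; simp [cf_add])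

theorem co_def (k : ℕ) (f : R) : co O k f = (cf O f).coeff k := rfl

theorem co_mono (k n : ℕ) (a : D) : co O k (O.i a * O.x ^ n) = if n = k then a else 0 := by
  rw [co_def, cf_mono, coeff_monomial]

theorem co_i (k : ℕ) (a : D) : co O k (O.i a) = if 0 = k then a else 0 := by
  simpa using co_mono O k 0 a

theorem R_ind {p : R → Prop} (hadd : ∀ f g, p f → p g → p (f + g))
    (hm : ∀ n a, p (O.i a * O.x ^ n)) (f : R) : p f := by
  rw [← ev_cf O f]
  induction cf O f using Polynomial.induction_on' with
  | add g h hg hh => rw [ev_add]; exact hadd _ _ hg hh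
  | monomial n a => rw [ev_monomial]; exact hm n a

theorem co_imul (k : ℕ) (a : D) (f : R) : co O k (O.i a * f) = a * co O k f := by
  induction f using R_ind O with
  | hadd f g hf hg => simp [mul_add, hf, hg]
  | hm n b => rw [← mul_assoc, ← map_mul, co_mono, co_mono]; split_ifs <;> simp

theorem co_mulx_succ (k : ℕ) (f : R) : co O (k+1) (f * O.x) = co O k f := by
  induction f using R_ind O with
  | hadd f g hf hg => simp [add_mul, hf, hg]
  | hm n b => rw [mul_assoc, ← pow_succ, co_mono, co_mono]; simp

theorem co_mulx_zero (f : R) : co O 0 (f * O.x) = 0 := by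
  induction f using R_ind O with
  | hadd f g hf hg => simp [add_mul, hf, hg]
  | hm n b => rw [mul_assoc, ← pow_succ, co_mono]; simp

theorem x_mono (n : ℕ) (a : D) :
    O.x * (O.i a * O.x ^ n) = O.i (σ a) * O.x ^ (n+1) + O.i (δ a) * O.x ^ n := by
  rw [← mul_assoc, O.comm, add_mul, mul_assoc, ← pow_succ']
  rfl

theorem d_zero (hadd : ∀ a b : D, δ (a + b) = δ a + δ b) : δ 0 = 0 := by
  have := hadd 0 0
  simpa using this

theorem co_xmul_succ (hadd : ∀ a b : D, δ (a + b) = δ a + δ b) (k : ℕ) (f : R) :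
    co O (k+1) (O.x * f) = σ (co O k f) + δ (co O (k+1) f) := by
  induction f using R_ind O with
  | hadd f g hf hg => simp only [mul_add, hf, hg, map_add, hadd]; abel
  | hm n b =>
    rw [x_mono, map_add, co_mono, co_mono, co_mono, co_mono]
    have := d_zero hadd
    split_ifs <;> simp_all

theorem co_xmul_zero (hadd : ∀ a b : D, δ (a + b) = δ a + δ b) (f : R) :
    co O 0 (O.x * f) = δ (co O 0 f) := by
  induction f using R_ind O with
  | hadd f g hf hg => simp only [mul_add, hf, hg, map_add, hadd]
  | hm n b =>
    rw [x_mono, map_add, co_mono, co_mono, co_mono]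
    have := d_zero hadd
    split_ifs <;> simp_all

theorem mem_pSet (I : Ideal D) (f : R) : f ∈ O.pSet I ↔ ∀ k, co O k f ∈ I := by
  constructor
  · rintro ⟨g, hg, hf⟩ k
    have : f = ev O g := hf
    rw [co_def, this, cf_ev]; exact hg k
  · intro h
    exact ⟨cf O f, h, (ev_cf O f).symm⟩

theorem sum_repr (f : R) : f = ∑ k ∈ (cf O f).support, O.i (co O k f) * O.x ^ k := by
  conv_lhs => rw [← ev_cf O f]
  rfl

theorem pSet_sub (I : Ideal D) (P : Set R) (hP : IsTwoSidedIdealSet P)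
    (h : ∀ a ∈ I, O.i a ∈ P) : O.pSet I ⊆ P := by
  intro f hf
  rw [mem_pSet] at hf
  rw [sum_repr O f]
  apply Finset.sum_induction _ (· ∈ P) hP.2.1 hP.1
  intro k _
  exact hP.2.2.2 _ _ (h _ (hf k))

theorem pSet_ideal (hadd : ∀ a b : D, δ (a + b) = δ a + δ b) (I : Ideal D)
    (hI : SDIdeal (⇑σ) δ I) : IsTwoSidedIdealSet (O.pSet I) := by
  have hz : (0 : R) ∈ O.pSet I := by rw [mem_pSet]; simp
  have ha : ∀ a b : R, a ∈ O.pSet I → b ∈ O.pSet I → a + b ∈ O.pSet I := by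
    intro a b h1 h2
    rw [mem_pSet] at *
    intro k; rw [map_add]; exact I.add_mem (h1 k) (h2 k)
  have hx : ∀ a : R, a ∈ O.pSet I → O.x * a ∈ O.pSet I := by
    intro a h
    rw [mem_pSet] at *
    rintro (_ | k)
    · rw [co_xmul_zero O hadd]; exact hI.2 _ (h 0)
    · rw [co_xmul_succ O hadd]; exact I.add_mem (hI.1 _ (h k)) (hI.2 _ (h (k+1)))
  have hxn : ∀ n : ℕ, ∀ a : R, a ∈ O.pSet I → O.x ^ n * a ∈ O.pSet I := by
    intro n
    induction n with
    | zero => intro a h; simpa using h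
    | succ n ih => intro a h; rw [pow_succ', mul_assoc]; exact hx _ (ih _ h)
  refine ⟨hz, ha, ?_, ?_⟩
  · intro r a h
    induction r using R_ind O with
    | hadd f g hf hg => rw [add_mul]; exact ha _ _ hf hg
    | hm n b =>
      rw [mul_assoc, mem_pSet]
      intro k
      rw [co_imul]
      exact I.mul_mem_left _ ((mem_pSet O I _).1 (hxn n a h) k)
  · intro r a h
    rw [mem_pSet] at h
    rw [sum_repr O a, Finset.sum_mul]
    apply Finset.sum_induction _ (· ∈ O.pSet I) ha hz
    intro k _
    rw [mul_assoc, mem_pSet]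
    intro j
    rw [co_imul]
    exact I.mul_mem_right _ (h k)

/-- degree at most n modulo I -/
def DegLE (I : Ideal D) (n : ℕ) (f : R) : Prop := ∀ k, n < k → co O k f ∈ I

theorem deg_xpow (hadd : ∀ a b : D, δ (a + b) = δ a + δ b) (I : Ideal D)
    (hI : SDIdeal (⇑σ) δ I) (n : ℕ) (g : R) (hg : DegLE O I n g) (k : ℕ) :
    DegLE O I (n + k) (O.x ^ k * g) ∧
      co O (n + k) (O.x ^ k * g) - (σ^[k]) (co O n g) ∈ I := by
  induction k with
  | zero => simpa using hg
  | succ k ih =>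
    obtain ⟨h1, h2⟩ := ih
    rw [pow_succ', mul_assoc]
    refine ⟨?_, ?_⟩
    · intro j hj
      obtain ⟨j, rfl⟩ : ∃ i, j = i + 1 := ⟨j - 1, by omega⟩
      rw [co_xmul_succ O hadd]
      exact I.add_mem (hI.1 _ (h1 _ (by omega))) (hI.2 _ (h1 _ (by omega)))
    · rw [← add_assoc, co_xmul_succ O hadd, Function.iterate_succ_apply', add_sub_right_comm,
        ← map_sub]
      exact I.add_mem (hI.1 _ h2) (hI.2 _ (h1 _ (by omega)))

theorem co_mul_top (hadd : ∀ a b : D, δ (a + b) = δ a + δ b) (I : Ideal D)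
    (hI : SDIdeal (⇑σ) δ I) (m n : ℕ) (h g : R) (hh : DegLE O I m h) (hg : DegLE O I n g) :
    co O (n + m) (h * g) - co O m h * (σ^[m]) (co O n g) ∈ I := by
  have key : co O (n + m) (h * g) =
      ∑ k ∈ (cf O h).support, co O k h * co O (n + m) (O.x ^ k * g) := by
    conv_lhs => rw [sum_repr O h, Finset.sum_mul, map_sum]
    apply Finset.sum_congr rfl
    intro k _
    rw [mul_assoc, co_imul]
  have key2 : co O m h * (σ^[m]) (co O n g) =
      ∑ k ∈ (cf O h).support, if k = m then co O m h * (σ^[m]) (co O n g) else 0 := by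
    rw [Finset.sum_ite_eq']
    split_ifs with hm
    · rfl
    · have : co O m h = 0 := by rw [co_def]; simpa using hm
      rw [this, zero_mul]
  rw [key, key2, ← Finset.sum_sub_distrib]
  apply I.sum_mem
  intro k _
  split_ifs with hk
  · subst hk
    rw [← mul_sub]
    exact I.mul_mem_left _ (deg_xpow O hadd I hI n g hg k).2
  · rw [sub_zero]
    rcases lt_or_gt_of_ne hk with hk | hk
    · exact I.mul_mem_left _ ((deg_xpow O hadd I hI n g hg k).1 _ (by omega))
    · exact I.mul_mem_right _ (hh k hk)

theorem exists_top (I : Ideal D) (f : R) (hf : f ∉ O.pSet I) :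
    ∃ n, DegLE O I n f ∧ co O n f ∉ I := by
  classical
  rw [mem_pSet] at hf
  push Not at hf
  obtain ⟨k, hk⟩ := hf
  have hb : ∀ j, co O j f ∉ I → j ≤ (cf O f).natDegree := by
    intro j hj
    by_contra hlt
    apply hj
    rw [co_def, coeff_eq_zero_of_natDegree_lt (by omega)]
    exact I.zero_mem
  refine ⟨Nat.findGreatest (fun j => co O j f ∉ I) (cf O f).natDegree, ?_, ?_⟩
  · intro j hj
    by_contra h
    have := Nat.le_findGreatest (P := fun j => co O j f ∉ I) (hb j h) h
    omega
  · exact Nat.findGreatest_spec (P := fun j => co O j f ∉ I) (hb k hk) hk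

end ring

section comm
variable {D : Type*} [CommRing D] {σ : D ≃+* D} {δ : D → D}

theorem sd_mul (hadd : ∀ a b : D, δ (a + b) = δ a + δ b)
    (hleib : ∀ a b : D, δ (a * b) = σ a * δ b + δ a * b) (I J : Ideal D)
    (hI : SDIdeal (⇑σ) δ I) (hJ : SDIdeal (⇑σ) δ J) : SDIdeal (⇑σ) δ (I * J) := by
  constructor
  · intro a ha
    induction ha using Submodule.mul_induction_on' with
    | mem_mul_mem m hm n hn => rw [map_mul]; exact Ideal.mul_mem_mul (hI.1 _ hm) (hJ.1 _ hn)
    | add x _ y _ hx hy => rw [map_add]; exact add_mem hx hy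
  · intro a ha
    induction ha using Submodule.mul_induction_on' with
    | mem_mul_mem m hm n hn =>
      rw [hleib]
      exact add_mem (Ideal.mul_mem_mul (hI.1 _ hm) (hJ.2 _ hn))
        (Ideal.mul_mem_mul (hI.2 _ hm) hn)
    | add x _ y _ hx hy => rw [hadd]; exact add_mem hx hy

theorem sd_pow (hadd : ∀ a b : D, δ (a + b) = δ a + δ b)
    (hleib : ∀ a b : D, δ (a * b) = σ a * δ b + δ a * b) (I : Ideal D)
    (hI : SDIdeal (⇑σ) δ I) (n : ℕ) : SDIdeal (⇑σ) δ (I ^ n) := by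
  induction n with
  | zero => rw [pow_zero, Ideal.one_eq_top]; exact ⟨fun _ _ => trivial, fun _ _ => trivial⟩
  | succ n ih => rw [pow_succ]; exact sd_mul hadd hleib _ _ ih hI

theorem sdprime_pow (hadd : ∀ a b : D, δ (a + b) = δ a + δ b)
    (hleib : ∀ a b : D, δ (a * b) = σ a * δ b + δ a * b) (Q I : Ideal D)
    (hQ : SDPrime (⇑σ) δ Q) (hI : SDIdeal (⇑σ) δ I) (n : ℕ) (h : I ^ n ≤ Q) : I ≤ Q := by
  induction n with
  | zero =>
    rw [pow_zero, Ideal.one_eq_top] at h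
    exact le_top.trans h
  | succ n ih =>
    rw [pow_succ] at h
    rcases hQ.2.2 _ _ (sd_pow hadd hleib I hI n) hI h with h | h
    · exact ih h
    · exact h

theorem sinv [IsNoetherianRing D] (I : Ideal D) (hI : ∀ a ∈ I, σ a ∈ I) (u : D)
    (hu : σ u ∈ I) : u ∈ I := by
  let f : ℕ →o Ideal D :=
    ⟨fun n => I.comap ((σ : D →+* D) ^ n), by
      apply monotone_nat_of_le_succ
      intro n a ha
      rw [Ideal.mem_comap, RingHom.coe_pow] at *
      rw [Function.iterate_succ_apply']
      exact hI _ ha⟩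
  obtain ⟨n, hn⟩ := monotone_stabilizes_iff_noetherian.2 (inferInstance : IsNoetherian D D) f
  have h1 := hn (n+1) (by omega)
  obtain ⟨w, rfl⟩ : ∃ w, (σ^[n]) w = u := (σ.surjective.iterate n) u
  have h2 : w ∈ f (n+1) := by
    change _ ∈ I.comap ((σ : D →+* D) ^ (n+1))
    rw [Ideal.mem_comap, RingHom.coe_pow, Function.iterate_succ_apply']
    exact hu
  rw [← h1] at h2
  change _ ∈ I.comap ((σ : D →+* D) ^ n) at h2
  rw [Ideal.mem_comap, RingHom.coe_pow] at h2
  exact h2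

theorem sinv_iter [IsNoetherianRing D] (I : Ideal D) (hI : ∀ a ∈ I, σ a ∈ I) (k : ℕ) (u : D)
    (hu : (σ^[k]) u ∈ I) : u ∈ I := by
  induction k with
  | zero => exact hu
  | succ k ih =>
    rw [Function.iterate_succ_apply'] at hu
    exact ih (sinv I hI _ hu)

/-- colon ideal -/
def quo (Q C : Ideal D) : Ideal D where
  carrier := {v | ∀ u ∈ C, u * v ∈ Q}
  zero_mem' := by intro u _; simp
  add_mem' := by intro a b ha hb u hu; rw [mul_add]; exact Q.add_mem (ha u hu) (hb u hu)
  smul_mem' := by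
    intro c a ha u hu
    rw [smul_eq_mul, mul_left_comm]; exact Q.mul_mem_left _ (ha u hu)

theorem mem_quo (Q C : Ideal D) (v : D) : v ∈ quo Q C ↔ ∀ u ∈ C, u * v ∈ Q := Iff.rfl

theorem sd_quo [IsNoetherianRing D]
    (hleib : ∀ a b : D, δ (a * b) = σ a * δ b + δ a * b) (Q C : Ideal D)
    (hQ : SDIdeal (⇑σ) δ Q) (hC : SDIdeal (⇑σ) δ C) : SDIdeal (⇑σ) δ (quo Q C) := by
  constructor
  · intro v hv u hu
    obtain ⟨w, rfl⟩ := σ.surjective u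
    rw [← map_mul]
    exact hQ.1 _ (hv w (sinv C hC.1 w hu))
  · intro v hv u hu
    obtain ⟨w, rfl⟩ := σ.surjective u
    have hw := sinv C hC.1 w hu
    have h1 := hQ.2 _ (hv w hw)
    rw [hleib] at h1
    exact (Ideal.add_mem_iff_left Q (hv _ (hC.2 _ hw))).1 h1

/-- Case A: radical SD-primes are "σ-prime". -/
theorem caseA [IsNoetherianRing D]
    (hadd : ∀ a b : D, δ (a + b) = δ a + δ b)
    (hleib : ∀ a b : D, δ (a * b) = σ a * δ b + δ a * b) (Q : Ideal D)
    (hQ : SDPrime (⇑σ) δ Q) (hrad : Q.IsRadical) (a b : D) (m : ℕ)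
    (hab : ∀ k, m ≤ k → a * (σ^[k]) b ∈ Q) : a ∈ Q ∨ b ∈ Q := by
  let f : ℕ →o Ideal D :=
    ⟨fun n =>
      { carrier := {u | ∀ k, n ≤ k → u * (σ^[k]) b ∈ Q}
        zero_mem' := by intro u _; simp
        add_mem' := by intro a b ha hb u hu; rw [add_mul]; exact Q.add_mem (ha u hu) (hb u hu)
        smul_mem' := by
          intro c a ha u hu
          rw [smul_eq_mul, mul_assoc]; exact Q.mul_mem_left _ (ha u hu) }, by
      intro n n' hn u hu k hk
      exact hu k (hn.trans hk)⟩
  have memf : ∀ n u, u ∈ f n ↔ ∀ k, n ≤ k → u * (σ^[k]) b ∈ Q := fun _ _ => Iff.rfl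
  obtain ⟨n, hn⟩ := monotone_stabilizes_iff_noetherian.2 (inferInstance : IsNoetherian D D) f
  have hs : ∀ u ∈ f n, σ u ∈ f n := by
    intro u hu
    rw [hn (n+1) (by omega), memf]
    intro k hk
    obtain ⟨k, rfl⟩ : ∃ i, k = i + 1 := ⟨k - 1, by omega⟩
    rw [Function.iterate_succ_apply', ← map_mul]
    exact hQ.2.1.1 _ (hu k (by omega))
  have hU : SDIdeal (⇑σ) δ (f n) := by
    refine ⟨hs, ?_⟩
    intro u hu k hk
    have h1 := hQ.2.1.2 _ (hu k hk)
    rw [hleib] at h1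
    have h2 := hs u hu k hk
    apply hrad
    refine ⟨2, ?_⟩
    have h3 : (δ u * (σ^[k]) b)^2 =
        δ u * (σ^[k]) b * (σ u * δ ((σ^[k]) b) + δ u * (σ^[k]) b)
          - δ u * δ ((σ^[k]) b) * (σ u * (σ^[k]) b) := by ring
    rw [h3]
    exact Q.sub_mem (Q.mul_mem_left _ h1) (Q.mul_mem_left _ h2)
  have hV := sd_quo hleib Q (f n) hQ.2.1 hU
  have hUV : f n * quo Q (f n) ≤ Q := by
    rw [Ideal.mul_le]
    intro r hr s hs
    exact hs r hr
  rcases hQ.2.2 _ _ hU hV hUV with h | h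
  · left
    apply h
    have : a ∈ f (max n m) := fun k hk => hab k ((le_max_right _ _).trans hk)
    rw [hn (max n m) (le_max_left _ _)]
    exact this
  · right
    have : (σ^[n]) b ∈ quo Q (f n) := fun u hu => hu n le_rfl
    exact sinv_iter Q hQ.2.1.1 n b (h this)

end comm

section ded
variable {D : Type*} [CommRing D] [IsDomain D] [IsDedekindDomain D] {σ : D ≃+* D} {δ : D → D}

theorem dichotomy
    (hadd : ∀ a b : D, δ (a + b) = δ a + δ b)
    (hleib : ∀ a b : D, δ (a * b) = σ a * δ b + δ a * b) (Q : Ideal D) (hQ0 : Q ≠ ⊥)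
    (hQ : SDPrime (⇑σ) δ Q) :
    Q.IsRadical ∨ ∃ (p : Ideal D) (n : ℕ), p.IsPrime ∧ p ≠ ⊥ ∧ (∀ a ∈ p, σ a ∈ p) ∧
      Q = p ^ n := by
  have hsr : ∀ a ∈ Q.radical, σ a ∈ Q.radical := by
    rintro a ⟨n, hn⟩
    refine ⟨n, ?_⟩
    rw [← map_pow]
    exact hQ.2.1.1 _ hn
  by_cases hd : ∀ a ∈ Q.radical, δ a ∈ Q.radical
  · left
    obtain ⟨n, hn⟩ := Ideal.exists_radical_pow_le_of_fg Q (IsNoetherian.noetherian _)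
    exact sdprime_pow hadd hleib Q _ hQ ⟨hsr, hd⟩ n hn
  · right
    push Not at hd
    obtain ⟨a, ha, hda⟩ := hd
    rw [Ideal.radical_eq_sInf, Submodule.mem_sInf] at hda
    push Not at hda
    obtain ⟨p, ⟨hQp, hp⟩, hdp⟩ : ∃ p : Ideal D, (Q ≤ p ∧ p.IsPrime) ∧ δ a ∉ p := hda
    have hrp : Q.radical ≤ p := hp.radical_le_iff.2 hQp
    have hsp : ∀ b, σ b - b ∈ p := by
      intro b
      have h1 : (σ a - a) * δ b = (σ b - b) * δ a := by
        have h2 := hleib a b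
        have h3 := hleib b a
        rw [mul_comm b a] at h3
        linear_combination h3 - h2
      have h2 : (σ b - b) * δ a ∈ p := by
        rw [← h1]
        exact Ideal.mul_mem_right _ p (Submodule.sub_mem p (hrp (hsr a ha)) (hrp ha))
      exact (hp.mem_or_mem h2).resolve_right hdp
    have hs1 : ∀ b ∈ p, σ b ∈ p := by
      intro b hb
      simpa using p.add_mem (hsp b) hb
    have hs2 : ∀ b, b ∉ p → σ b ∉ p := fun b hb h => hb (sinv p hs1 b h)
    have hp0 : p ≠ ⊥ := fun h => hQ0 (le_bot_iff.1 (h ▸ hQp))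
    have hpp : Prime p := Ideal.prime_of_isPrime hp0 hp
    obtain ⟨n, N, hQN, hN⟩ : ∃ (n : ℕ) (N : Ideal D), Q = p ^ n * N ∧ ¬ p ∣ N :=
      ⟨_, (FiniteMultiplicity.of_prime_left hpp hQ0).exists_eq_pow_mul_and_not_dvd⟩
    rw [Ideal.dvd_iff_le] at hN
    obtain ⟨s, hsN, hs⟩ := Set.not_subset.1 hN
    have hQn : Q ≤ p ^ n := by rw [hQN]; exact Ideal.mul_le_left
    have hcan : ∀ t a, t ∉ p → t * a ∈ p ^ n → a ∈ p ^ n := by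
      intro t a ht hta
      exact (Ideal.IsPrime.mul_mem_pow p hta).resolve_left ht
    have hsat : ∀ a ∈ p ^ n, a * s ∈ Q := by
      intro a ha
      rw [hQN]; exact Ideal.mul_mem_mul ha hsN
    have hps : ∀ k, ∀ a ∈ p ^ k, σ a ∈ p ^ k := by
      intro k
      have : p ^ k ≤ (p^k).comap (σ : D →+* D) := by
        rw [← Ideal.map_le_iff_le_comap, Ideal.map_pow]
        exact Ideal.pow_right_mono (Ideal.map_le_iff_le_comap.2 hs1) k
      exact this
    have hpn : SDIdeal (⇑σ) δ (p ^ n) := by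
      refine ⟨hps n, ?_⟩
      intro a ha
      have h1 := hQn (hQ.2.1.2 _ (hsat a ha))
      rw [mul_comm, hleib] at h1
      have h2 := (Ideal.add_mem_iff_left (p^n) ((p^n).mul_mem_left _ ha)).1 h1
      exact hcan _ _ (hs2 s hs) h2
    have hV := sd_quo hleib Q (p^n) hQ.2.1 hpn
    have hUV : p ^ n * quo Q (p ^ n) ≤ Q := by
      rw [Ideal.mul_le]
      intro r hr s hs
      exact hs r hr
    refine ⟨p, n, hp, hp0, hs1, le_antisymm hQn ?_⟩
    rcases hQ.2.2 _ _ hpn hV hUV with h | h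
    · exact h
    · exact absurd (hQp (h hsat)) hs

end ded

section main
variable {D R : Type*} [CommRing D] [IsDomain D] [IsDedekindDomain D] [Ring R]
  {σ : D ≃+* D} {δ : D → D} (O : OreData D R (σ : D →+* D) δ)

theorem caseB
    (hadd : ∀ a b : D, δ (a + b) = δ a + δ b)
    (hleib : ∀ a b : D, δ (a * b) = σ a * δ b + δ a * b) (Q : Ideal D)
    (hQ : SDPrime (⇑σ) δ Q) (p : Ideal D) (e : ℕ) (hp : p.IsPrime) (hp0 : p ≠ ⊥)
    (hs : ∀ a ∈ p, σ a ∈ p) (hQp : Q = p ^ e) (A : Set R) (hA : IsTwoSidedIdealSet A)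
    (hQA : O.pSet Q ⊆ A) (f : R) (hfA : f ∈ A) (hf : f ∉ O.pSet Q) :
    ∃ m h, h ∈ A ∧ DegLE O Q m h ∧ co O m h = 1 := by
  classical
  have hps : ∀ k, ∀ a ∈ p ^ k, σ a ∈ p ^ k := by
    intro k
    have : p ^ k ≤ (p^k).comap (σ : D →+* D) := by
      rw [← Ideal.map_le_iff_le_comap, Ideal.map_pow]
      exact Ideal.pow_right_mono (Ideal.map_le_iff_le_comap.2 hs) k
    exact this
  have hpp : Prime p := Ideal.prime_of_isPrime hp0 hp
  have hex : ∃ m, ∃ f ∈ A, DegLE O Q m f ∧ co O m f ∉ Q := by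
    obtain ⟨n, h1, h2⟩ := exists_top O Q f hf
    exact ⟨n, f, hfA, h1, h2⟩
  obtain ⟨m, hm, hmin⟩ : ∃ m, (∃ f ∈ A, DegLE O Q m f ∧ co O m f ∉ Q) ∧
      ∀ f ∈ A, DegLE O Q m f → co O m f ∈ Q → f ∈ O.pSet Q := by
    refine ⟨Nat.find hex, Nat.find_spec hex, ?_⟩
    intro f hf hd hc
    by_contra hn
    obtain ⟨n, h1, h2⟩ := exists_top O Q f hn
    have h3 : Nat.find hex ≤ n := Nat.find_min' hex ⟨f, hf, h1, h2⟩
    rcases h3.eq_or_lt with h | h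
    · exact h2 (h ▸ hc)
    · exact h2 (hd n h)
  let T : Ideal D :=
    { carrier := {c | ∃ f ∈ A, DegLE O Q m f ∧ co O m f = c}
      zero_mem' := ⟨0, hA.1, by intro k _; simp, by simp⟩
      add_mem' := by
        rintro a b ⟨f, hf, hfd, rfl⟩ ⟨g, hg, hgd, rfl⟩
        refine ⟨f + g, hA.2.1 _ _ hf hg, ?_, by simp⟩
        intro k hk
        rw [map_add]; exact Q.add_mem (hfd k hk) (hgd k hk)
      smul_mem' := by
        rintro c a ⟨f, hf, hfd, rfl⟩
        refine ⟨O.i c * f, hA.2.2.1 _ _ hf, ?_, by rw [co_imul]; rfl⟩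
        intro k hk
        rw [co_imul]; exact Q.mul_mem_left _ (hfd k hk) }
  have memT : ∀ c, c ∈ T ↔ ∃ f ∈ A, DegLE O Q m f ∧ co O m f = c := fun _ => Iff.rfl
  have hQT : Q ≤ T := by
    intro c hc
    refine ⟨O.i c * O.x ^ m, ?_, ?_, by rw [co_mono]; simp⟩
    · apply hQA
      rw [mem_pSet]
      intro k
      rw [co_mono]; split_ifs
      · exact hc
      · exact Q.zero_mem
    · intro k hk
      rw [co_mono, if_neg (by omega)]; exact Q.zero_mem
  obtain ⟨j, hje, hTj⟩ : ∃ j ≤ e, T = p ^ j := by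
    have : T ∣ p ^ e := by rw [Ideal.dvd_iff_le, ← hQp]; exact hQT
    obtain ⟨j, hj, h⟩ := (dvd_prime_pow hpp e).1 this
    exact ⟨j, hj, associated_iff_eq.1 h⟩
  have hTs : ∀ a ∈ T, σ a ∈ T := by rw [hTj]; exact hps j
  have hcoef : ∀ f ∈ A, DegLE O Q m f → ∀ k, co O k f ∈ T := by
    intro f hf hd k
    have h1 : ∀ a ∈ p ^ (e - j), a * co O k f ∈ Q := by
      intro a ha
      have h2 : O.i a * f ∈ O.pSet Q := by
        apply hmin _ (hA.2.2.1 _ _ hf)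
        · intro l hl
          rw [co_imul]; exact Q.mul_mem_left _ (hd l hl)
        · rw [co_imul]
          have h3 : co O m f ∈ p ^ j := by rw [← hTj]; exact ⟨f, hf, hd, rfl⟩
          have := Ideal.mul_mem_mul ha h3
          rwa [← pow_add, Nat.sub_add_cancel hje, ← hQp] at this
      have := (mem_pSet O Q _).1 h2 k
      rwa [co_imul] at this
    have h2 : p ^ (e - j) * Ideal.span {co O k f} ≤ p ^ (e - j) * p ^ j := by
      rw [← pow_add, Nat.sub_add_cancel hje, ← hQp, Ideal.mul_le]
      intro r hr s hs
      obtain ⟨t, rfl⟩ := Ideal.mem_span_singleton'.1 hs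
      rw [mul_left_comm]
      exact Q.mul_mem_left _ (h1 r hr)
    rw [← Ideal.dvd_iff_le] at h2
    have h3 := (mul_dvd_mul_iff_left (pow_ne_zero _ hpp.ne_zero)).1 h2
    rw [Ideal.dvd_iff_le, Ideal.span_singleton_le_iff_mem, ← hTj] at h3
    exact h3
  have hTd : ∀ a ∈ T, δ a ∈ T := by
    intro c hc
    obtain ⟨f', hf', hd', hc'⟩ := hTs c hc
    obtain ⟨f, hf, hd, rfl⟩ := hc
    have hmem : O.x * f - f' * O.x ∈ A := by
      have h1 : O.x * f - f' * O.x = O.x * f + (-1) * (f' * O.x) := by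
        rw [neg_one_mul, sub_eq_add_neg]
      rw [h1]
      exact hA.2.1 _ _ (hA.2.2.1 _ _ hf) (hA.2.2.1 _ _ (hA.2.2.2 _ _ hf'))
    have hdeg : DegLE O Q m (O.x * f - f' * O.x) := by
      intro k hk
      obtain ⟨k, rfl⟩ : ∃ i, k = i + 1 := ⟨k - 1, by omega⟩
      rw [map_sub, co_xmul_succ O hadd, co_mulx_succ]
      have h1 : δ (co O (k+1) f) ∈ Q := hQ.2.1.2 _ (hd _ hk)
      rcases (Nat.lt_succ_iff.1 hk).eq_or_lt with h | h
      · subst h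
        rw [hc', add_sub_cancel_left]; exact h1
      · exact Q.sub_mem (Q.add_mem (hQ.2.1.1 _ (hd _ h)) h1) (hd' _ h)
    have h1 := hcoef _ hmem hdeg m
    have c1 := hcoef _ hf hd
    have c2 := hcoef _ hf' hd'
    clear hdeg hmem
    rcases m with _ | m
    · rw [map_sub, co_xmul_zero O hadd, co_mulx_zero, sub_zero] at h1
      exact h1
    · rw [map_sub, co_xmul_succ O hadd, co_mulx_succ] at h1
      have h2 := T.add_mem h1 (c2 m)
      rw [sub_add_cancel] at h2
      exact (Ideal.add_mem_iff_right T (hTs _ (c1 m))).1 h2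
  rcases Nat.eq_zero_or_pos j with h | h
  · have : (1 : D) ∈ T := by rw [hTj, h, pow_zero]; simp
    obtain ⟨f, hf, hd, h1⟩ := this
    exact ⟨m, f, hf, hd, h1⟩
  · exfalso
    have h1 : T ^ e ≤ Q := by
      rw [hTj, hQp, ← pow_mul]
      exact Ideal.pow_le_pow_right (Nat.le_mul_of_pos_left e h)
    have h2 := sdprime_pow hadd hleib Q T hQ ⟨hTs, hTd⟩ e h1
    obtain ⟨f, hf, hd, hc⟩ := hm
    exact hc (h2 ⟨f, hf, hd, rfl⟩)

theorem pSet_prime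
    (hadd : ∀ a b : D, δ (a + b) = δ a + δ b)
    (hleib : ∀ a b : D, δ (a * b) = σ a * δ b + δ a * b) (Q : Ideal D) (hQ0 : Q ≠ ⊥)
    (hQ : SDPrime (⇑σ) δ Q) : IsPrimeTS (O.pSet Q) := by
  have hid := pSet_ideal O hadd Q hQ.2.1
  refine ⟨hid, ?_, ?_⟩
  · intro h
    apply hQ.1
    rw [Ideal.eq_top_iff_one]
    have h1 : O.i 1 ∈ O.pSet Q := h ▸ Set.mem_univ _
    have h2 := (mem_pSet O Q _).1 h1 0
    rw [co_i, if_pos rfl] at h2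
    exact h2
  · intro f g hfg
    by_contra hcon
    push Not at hcon
    obtain ⟨hf, hg⟩ := hcon
    obtain ⟨n, hgd, hgc⟩ := exists_top O Q g hg
    rcases dichotomy hadd hleib Q hQ0 hQ with hr | ⟨p, e, hp, hp0, hs, hQp⟩
    · obtain ⟨m, hfd, hfc⟩ := exists_top O Q f hf
      have := caseA hadd hleib Q hQ hr (co O m f) (co O n g) m (by
        intro k hk
        obtain ⟨k, rfl⟩ := Nat.exists_eq_add_of_le hk
        obtain ⟨h1, h2⟩ := deg_xpow O hadd Q hQ.2.1 n g hgd k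
        have h3 := co_mul_top O hadd Q hQ.2.1 m (n + k) f _ hfd h1
        have h4 := (mem_pSet O Q _).1 (hfg (O.x ^ k)) (n + k + m)
        rw [mul_assoc] at h4
        have h5 := (Submodule.sub_mem_iff_right Q h4).1 h3
        have h6 : (σ^[m]) (co O (n + k) (O.x ^ k * g)) - (σ^[m]) ((σ^[k]) (co O n g)) ∈ Q := by
          have : ∀ (m : ℕ) (u v : D), u - v ∈ Q → (σ^[m]) u - (σ^[m]) v ∈ Q := by
            intro m
            induction m with
            | zero => intro u v h; exact h
            | succ m ih =>
              intro u v h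
              rw [Function.iterate_succ_apply', Function.iterate_succ_apply', ← map_sub]
              exact hQ.2.1.1 _ (ih u v h)
          exact this m _ _ h2
        rw [Function.iterate_add_apply]
        have h7 := Q.mul_mem_left (co O m f) h6
        rw [mul_sub] at h7
        exact (Submodule.sub_mem_iff_right Q h5).1 h7)
      rcases this with h | h
      · exact hfc h
      · exact hgc h
    · obtain ⟨m, h, hA, hd, hc⟩ := caseB O hadd hleib Q hQ p e hp hp0 hs hQp
        {h | ∀ r, h * r * g ∈ O.pSet Q} (by
          refine ⟨?_, ?_, ?_, ?_⟩
          · intro r; simpa using hid.1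
          · intro a b ha hb r
            rw [add_mul, add_mul]; exact hid.2.1 _ _ (ha r) (hb r)
          · intro s a ha r
            rw [mul_assoc s, mul_assoc s]; exact hid.2.2.1 _ _ (ha r)
          · intro s a ha r
            rw [mul_assoc a]; exact ha _)
        (by
          intro a ha r
          exact hid.2.2.2 _ _ (hid.2.2.2 _ _ ha)) f hfg hf
      have h1 := co_mul_top O hadd Q hQ.2.1 m n h g hd hgd
      have h2 := (mem_pSet O Q _).1 (hA 1) (n + m)
      rw [mul_one] at h2
      have h3 := (Submodule.sub_mem_iff_right Q h2).1 h1
      rw [hc, one_mul] at h3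
      exact hgc (sinv_iter Q hQ.2.1.1 m _ h3)

end main

end OreAux

/-- If `P` is a minimal prime ideal of `R` with `P ∩ D = 𝔭 ≠ 0`, then either
`P = 𝔭[x; σ, δ]` with `𝔭` a minimal `(σ, δ)`-prime ideal of `D`, or `(0)` is
the largest `(σ, δ)`-ideal of `D` contained in `𝔭`. -/
theorem stmt7 {D R : Type*} [CommRing D] [IsDomain D] [IsDedekindDomain D] [Ring R]
    (σ : D ≃+* D) (hσ : (⇑σ : D → D) ≠ id) (δ : D → D) (hδ0 : δ ≠ 0)
    (hadd : ∀ a b : D, δ (a + b) = δ a + δ b)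
    (hleib : ∀ a b : D, δ (a * b) = σ a * δ b + δ a * b)
    (O : OreData D R (σ : D →+* D) δ)
    (P : Set R) (𝔭 : Ideal D) (hcontr : O.i ⁻¹' P = ↑𝔭) (h0 : 𝔭 ≠ ⊥)
    (hmin : MinimalPrimeTS P) :
    (P = O.pSet 𝔭 ∧ MinSDPrime (⇑σ) δ 𝔭) ∨
      (∀ J : Ideal D, SDIdeal (⇑σ) δ J → J ≤ 𝔭 → J = ⊥) := by
  by_contra hcon
  push Not at hcon
  obtain ⟨hcon1, J, hJ, hJp, hJ0⟩ := hcon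
  obtain ⟨hP, hPne, hPmin⟩ := hmin
  have memp : ∀ a, a ∈ 𝔭 ↔ O.i a ∈ P := by
    intro a
    rw [← SetLike.mem_coe, ← hcontr]; rfl
  -- every nonzero SD-prime inside `𝔭` gives `P` and equals `𝔭`
  have key : ∀ Q : Ideal D, SDPrime (⇑σ) δ Q → Q ≠ ⊥ → Q ≤ 𝔭 → O.pSet Q = P ∧ Q = 𝔭 := by
    intro Q hQ hQ0 hQp
    have hne : O.pSet Q ≠ {0} := by
      intro h
      apply hQ0
      rw [eq_bot_iff]
      intro c hc
      have h1 : O.i c ∈ O.pSet Q := by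
        rw [OreAux.mem_pSet]
        intro k
        rw [OreAux.co_i]
        split_ifs
        · exact hc
        · exact Q.zero_mem
      rw [h, Set.mem_singleton_iff] at h1
      have h2 := OreAux.co_i O 0 c
      rw [h1] at h2
      simpa using h2.symm
    have h1 := hPmin _ (OreAux.pSet_prime O hadd hleib Q hQ0 hQ) hne
      (OreAux.pSet_sub O Q P hP.1 fun a ha => (memp a).1 (hQp ha))
    refine ⟨h1, le_antisymm hQp ?_⟩
    intro a ha
    rw [memp, ← h1, OreAux.mem_pSet] at ha
    simpa [OreAux.co_i] using ha 0
  -- products of SD-ideals in `𝔭`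
  have hprod : ∀ A B : Ideal D, SDIdeal (⇑σ) δ A → SDIdeal (⇑σ) δ B → A * B ≤ 𝔭 →
      A ≤ 𝔭 ∨ B ≤ 𝔭 := by
    intro A B _ hB hAB
    by_contra hc
    rw [not_or] at hc
    obtain ⟨h1, h2⟩ := hc
    obtain ⟨a, haA, ha⟩ := Set.not_subset.1 h1
    obtain ⟨b, hbB, hb⟩ := Set.not_subset.1 h2
    have hbS : O.i b ∈ O.pSet B := by
      rw [OreAux.mem_pSet]
      intro k
      rw [OreAux.co_i]
      split_ifs
      · exact hbB
      · exact B.zero_mem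
    rcases hP.2.2 (O.i a) (O.i b) (by
      intro r
      apply OreAux.pSet_sub O (A * B) P hP.1 fun a ha => (memp a).1 (hAB ha)
      rw [OreAux.mem_pSet]
      intro k
      rw [mul_assoc, OreAux.co_imul]
      apply Ideal.mul_mem_mul haA
      exact (OreAux.mem_pSet O B _).1 ((OreAux.pSet_ideal O hadd B hB).2.2.1 r _ hbS) k) with h | h
    · exact ha ((memp a).2 h)
    · exact hb ((memp b).2 h)
  let S : Set (Ideal D) := {I | SDIdeal (⇑σ) δ I ∧ I ≤ 𝔭}
  have hS : SDIdeal (⇑σ) δ (sSup S) := by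
    constructor
    · intro a ha
      rw [sSup_eq_iSup'] at ha ⊢
      induction ha using Submodule.iSup_induction' with
      | mem I x hx => exact Submodule.mem_iSup_of_mem I (I.2.1.1 x hx)
      | zero => simp
      | add x y _ _ hx hy => rw [map_add]; exact add_mem hx hy
    · intro a ha
      rw [sSup_eq_iSup'] at ha ⊢
      induction ha using Submodule.iSup_induction' with
      | mem I x hx => exact Submodule.mem_iSup_of_mem I (I.2.1.2 x hx)
      | zero => rw [OreAux.d_zero hadd]; exact zero_mem _
      | add x y _ _ hx hy => rw [hadd]; exact add_mem hx hy
  have hSp : sSup S ≤ 𝔭 := sSup_le fun I hI => hI.2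
  have hptop : 𝔭 ≠ ⊤ := by
    intro h
    apply hP.2.1
    rw [Set.eq_univ_iff_forall]
    intro r
    have h1 : O.i 1 ∈ P := (memp 1).1 (h ▸ trivial)
    have h2 := hP.1.2.2.1 r _ h1
    simpa using h2
  have hSprime : SDPrime (⇑σ) δ (sSup S) := by
    refine ⟨fun h => hptop (top_le_iff.1 (h ▸ hSp)), hS, ?_⟩
    intro A B hA hB hAB
    rcases hprod A B hA hB (hAB.trans hSp) with h | h
    · exact Or.inl (le_sSup ⟨hA, h⟩)
    · exact Or.inr (le_sSup ⟨hB, h⟩)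
  have hS0 : sSup S ≠ ⊥ := by
    intro h
    apply hJ0
    rw [eq_bot_iff, ← h]
    exact le_sSup ⟨hJ, hJp⟩
  obtain ⟨k1, k2⟩ := key _ hSprime hS0 hSp
  rw [k2] at k1 hSprime
  exact hcon1 k1.symm ⟨h0, hSprime, fun I hI hI0 hIp => (key I hI hI0 hIp).2⟩
end
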